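/- Let n ≥ 1, let λ be a D-partition of n, and assume |μ(λ)| ∉ {2, 2n−2}. Set d(λ) = (λ^t)_D, the D-collapse of λ^t. Then μ(λ) ⊆ d(λ). -/

import Mathlib

namespace WFPaper

/-- The list of parts of a partition (multiset of positive integers) in weakly
decreasing order. -/
def sortedDesc (s : Multiset ℕ) : List ℕ := (s.sort (· ≤ ·)).reverse

/-- The `j`-th largest part of `s` (1-indexed); `0` if `j = 0` or `j > #s`. -/
def part (s : Multiset ℕ) (j : ℕ) : ℕ := (sortedDesc s).getD (j - 1) 0

/-- The smallest part of `s` (`0` if `s` is empty). -/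
def minPart (s : Multiset ℕ) : ℕ := (s.sort (· ≤ ·)).getD 0 0

/-- Sum of the `j` largest parts of `s`. -/
def psum (s : Multiset ℕ) (j : ℕ) : ℕ := ((sortedDesc s).take j).sum

/-- Dominance order: `DomLE a b` means `a ≤ b` in the dominance order, i.e.
for every `j` the sum of the `j` largest parts of `a` is at most that of `b`. -/
def DomLE (a b : Multiset ℕ) : Prop := ∀ j, psum a j ≤ psum b j

/-- All parts are positive. -/
def PosParts (s : Multiset ℕ) : Prop := ∀ x ∈ s, 0 < x

/-- A partition of an odd number in which every even part has even multiplicity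
(a B-partition of `n` when the sum is `2*n+1`). -/
def IsTypeB (s : Multiset ℕ) : Prop :=
  PosParts s ∧ Odd s.sum ∧ ∀ x, Even x → Even (s.count x)

/-- A partition of an even number in which every odd part has even multiplicity
(a C-partition of `n` when the sum is `2*n`). -/
def IsTypeC (s : Multiset ℕ) : Prop :=
  PosParts s ∧ Even s.sum ∧ ∀ x, Odd x → Even (s.count x)

/-- A partition of an even number in which every even part has even multiplicity
(a D-partition of `n` when the sum is `2*n`). -/
def IsTypeD (s : Multiset ℕ) : Prop :=
  PosParts s ∧ Even s.sum ∧ ∀ x, Even x → Even (s.count x)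

/-- `IsCollapse T α β` : `β` is the dominance-largest partition of class `T` of
the same number as `α` which is dominated by `α` (e.g. the B/C/D-collapse of `α`
for `T = IsTypeB/IsTypeC/IsTypeD`). -/
def IsCollapse (T : Multiset ℕ → Prop) (α β : Multiset ℕ) : Prop :=
  T β ∧ β.sum = α.sum ∧ DomLE β α ∧
    ∀ γ, T γ → γ.sum = α.sum → DomLE γ α → DomLE γ β

/-- The transpose (conjugate) partition: its `j`-th part (0-indexed `j`) is the
number of parts of `s` that are `≥ j+1`. -/
def transpose (s : Multiset ℕ) : Multiset ℕ :=
  (Multiset.range (part s 1)).map (fun j => (s.filter (fun x => j + 1 ≤ x)).card)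

/-- `λ⁻` : subtract 1 from the smallest part (the part being deleted if it
becomes 0). -/
def decMin (s : Multiset ℕ) : Multiset ℕ :=
  ((minPart s - 1) ::ₘ s.erase (minPart s)).filter (fun x => 0 < x)

/-- `λ⁺` : add 1 to the largest part. -/
def incMax (s : Multiset ℕ) : Multiset ℕ :=
  (part s 1 + 1) ::ₘ s.erase (part s 1)

/-- The subpartition `μ` of `T` whose multiplicity at an even `x` is 2 if
`m_T(x)` is even and nonzero, 1 if `m_T(x)` is odd, and 0 at odd `x`. -/
def muEven (T : Multiset ℕ) : Multiset ℕ :=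
  (T.toFinset.filter (fun x => Even x)).val.bind
    (fun x => Multiset.replicate (if Even (T.count x) then 2 else 1) x)

/-- The subpartition `μ` of `T` whose multiplicity at an odd `x` is 2 if
`m_T(x)` is even and nonzero, 1 if `m_T(x)` is odd, and 0 at even `x`. -/
def muOdd (T : Multiset ℕ) : Multiset ℕ :=
  (T.toFinset.filter (fun x => Odd x)).val.bind
    (fun x => Multiset.replicate (if Even (T.count x) then 2 else 1) x)

/-- The subpartition `π` of `T` consisting of the even parts of `T` of odd
multiplicity, each taken once. -/
def piEven (T : Multiset ℕ) : Multiset ℕ :=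
  (T.toFinset.filter (fun x => Even x ∧ Odd (T.count x))).val

/-- `k` is a (1-indexed) position of an odd part of `s`. -/
def OddIdx (s : Multiset ℕ) (k : ℕ) : Prop := 1 ≤ k ∧ Odd (part s k)

/-- `k` is a (1-indexed) position of an even part of `s`. -/
def EvenIdx (s : Multiset ℕ) (k : ℕ) : Prop :=
  1 ≤ k ∧ k ≤ Multiset.card s ∧ Even (part s k)

/-- `e_s(i,j)` : number of positions `i ≤ k ≤ j` with `s_k` even. -/
def eCount (s : Multiset ℕ) (i j : ℕ) : ℕ :=
  ((Finset.Icc i j).filter (fun k => Even (part s k))).card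

/-- number of positions `i ≤ k ≤ j` with `s_k` odd. -/
def oCount (s : Multiset ℕ) (i j : ℕ) : ℕ :=
  ((Finset.Icc i j).filter (fun k => Odd (part s k))).card

/-- `s` is special in the e-count sense: `e_s(1,t₁)` is even, and
`e_s(tᵢ,tᵢ₊₁)` is even for all `1 ≤ i ≤ p-1`, where `t₁ < ⋯ < t_p` are the
positions of the odd parts of `s`. -/
def IsSpecialE (s : Multiset ℕ) : Prop :=
  (∀ t, OddIdx s t → (∀ t', OddIdx s t' → t ≤ t') → Even (eCount s 1 t)) ∧
  (∀ i j, OddIdx s i → OddIdx s j → i < j →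
    (∀ k, OddIdx s k → k ≤ i ∨ j ≤ k) → Even (eCount s i j))

/-- `s` is quasi-special: `e_s(1,t₁)` is even, `e_s(tᵢ,tᵢ₊₁)` is even for all
`1 ≤ i ≤ p-2`, and the smallest part of `s` is odd with multiplicity 1. -/
def IsQuasiSpecialE (s : Multiset ℕ) : Prop :=
  (∀ t, OddIdx s t → (∀ t', OddIdx s t' → t ≤ t') → Even (eCount s 1 t)) ∧
  (∀ i j, OddIdx s i → OddIdx s j → i < j →
    (∀ k, OddIdx s k → k ≤ i ∨ j ≤ k) → (∃ k, OddIdx s k ∧ j < k) →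
      Even (eCount s i j)) ∧
  Odd (minPart s) ∧ s.count (minPart s) = 1

/-- Number of odd parts greater than every even part (equals the number of odd
parts greater than the largest even part, and the number of all odd parts if
there are no even parts). -/
def numOddDominant (s : Multiset ℕ) : ℕ :=
  (s.filter (fun x => Odd x ∧ ∀ y ∈ s, Even y → y < x)).card

/-- Between every pair of consecutive even parts of `s` (in the decreasing
listing of the parts) there is an even number of odd parts. -/
def EvenBetween (s : Multiset ℕ) : Prop :=
  ∀ i j, EvenIdx s i → EvenIdx s j → i < j →
    (∀ k, EvenIdx s k → k ≤ i ∨ j ≤ k) → Even (oCount s i j)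

/-- A special B-partition. -/
def IsSpecialTypeB (s : Multiset ℕ) : Prop :=
  IsTypeB s ∧ EvenBetween s ∧ Odd (numOddDominant s)

/-- A special D-partition. -/
def IsSpecialTypeD (s : Multiset ℕ) : Prop :=
  IsTypeD s ∧ EvenBetween s ∧ Even (numOddDominant s)

/-- The parts of `s` in decreasing order, indexed from `0` and extended by `0`. -/
def seq (s : Multiset ℕ) (i : ℕ) : ℕ := (sortedDesc s).getD i 0

theorem coe_sortedDesc (s : Multiset ℕ) : (sortedDesc s : Multiset ℕ) = s := by
  simp [sortedDesc]

theorem length_sortedDesc (s : Multiset ℕ) : (sortedDesc s).length = s.card := by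
  simp [sortedDesc]

theorem pairwise_sortedDesc (s : Multiset ℕ) : (sortedDesc s).Pairwise (· ≥ ·) := by
  rw [sortedDesc, List.pairwise_reverse]
  exact s.pairwise_sort (· ≤ ·)

theorem sortedDesc_coe {L : List ℕ} (hL : L.Pairwise (· ≥ ·)) :
    sortedDesc (L : Multiset ℕ) = L :=
  List.Perm.eq_of_pairwise (le := (· ≥ ·)) (fun _ _ _ _ h₁ h₂ => le_antisymm h₂ h₁)
    (pairwise_sortedDesc _) hL (Multiset.coe_eq_coe.1 (coe_sortedDesc _))

theorem seq_eq_zero {s : Multiset ℕ} {i : ℕ} (h : s.card ≤ i) : seq s i = 0 :=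
  List.getD_eq_default _ _ (by rwa [length_sortedDesc])

theorem seq_antitone (s : Multiset ℕ) : Antitone (seq s) := by
  intro i j hij
  rcases lt_or_ge j s.card with hj | hj
  · rw [← length_sortedDesc] at hj
    rw [seq, seq, List.getD_eq_getElem _ _ hj, List.getD_eq_getElem _ _ (hij.trans_lt hj)]
    rcases hij.eq_or_lt with rfl | hlt
    · rfl
    · exact List.pairwise_iff_getElem.1 (pairwise_sortedDesc s) i j _ _ hlt
  · simp [seq_eq_zero hj]

theorem exists_seq_eq {s : Multiset ℕ} {x : ℕ} (h : x ∈ s) : ∃ i < s.card, seq s i = x := by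
  rw [← coe_sortedDesc s, Multiset.mem_coe] at h
  obtain ⟨i, hi, rfl⟩ := List.getElem_of_mem h
  exact ⟨i, by rwa [← length_sortedDesc], List.getD_eq_getElem _ _ hi⟩

theorem sum_take_eq_sum_getD (L : List ℕ) (j : ℕ) :
    (L.take j).sum = ∑ i ∈ Finset.range j, L.getD i 0 := by
  induction L generalizing j with
  | nil => simp
  | cons a L ih =>
    cases j with
    | zero => simp
    | succ j => simp [Finset.sum_range_succ', ih, add_comm]

theorem psum_eq (s : Multiset ℕ) (j : ℕ) : psum s j = ∑ i ∈ Finset.range j, seq s i :=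
  sum_take_eq_sum_getD _ _

theorem psum_succ (s : Multiset ℕ) (j : ℕ) : psum s (j + 1) = psum s j + seq s j := by
  simp [psum_eq, Finset.sum_range_succ]

theorem psum_eq_sum {s : Multiset ℕ} {N : ℕ} (h : s.card ≤ N) : psum s N = s.sum := by
  rw [psum, List.take_of_length_le (by rwa [length_sortedDesc]), ← Multiset.sum_coe,
    coe_sortedDesc]

theorem list_count_eq_sum (L : List ℕ) (x : ℕ) :
    L.count x = ∑ i ∈ Finset.range L.length, if L.getD i 0 = x then 1 else 0 := by
  induction L with
  | nil => simp
  | cons a L ih =>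
    rw [List.count_cons, ih, List.length_cons, Finset.sum_range_succ']
    simp only [List.getD_cons_succ, List.getD_cons_zero, beq_iff_eq]

theorem count_eq {s : Multiset ℕ} {x N : ℕ} (hx : 0 < x) (hN : s.card ≤ N) :
    s.count x = ((Finset.range N).filter (fun i => seq s i = x)).card := by
  have h : s.count x = ((Finset.range s.card).filter (fun i => seq s i = x)).card := by
    conv_lhs => rw [← coe_sortedDesc s, Multiset.coe_count, list_count_eq_sum, length_sortedDesc]
    rw [Finset.card_filter]
    rfl
  rw [h]
  congr 1
  ext i
  simp only [Finset.mem_filter, Finset.mem_range]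
  refine ⟨fun ⟨h₁, h₂⟩ => ⟨by omega, h₂⟩, fun ⟨_, h₂⟩ => ⟨?_, h₂⟩⟩
  by_contra hi
  rw [seq_eq_zero (by omega)] at h₂
  omega

theorem seq_coe_map_range {F : ℕ → ℕ} (hF : Antitone F) {M : ℕ} (hM : ∀ i, M ≤ i → F i = 0) :
    seq ((List.range M).map F : List ℕ) = F := by
  have hp : ((List.range M).map F).Pairwise (· ≥ ·) :=
    List.pairwise_map.2 (List.pairwise_lt_range.imp fun h => hF h.le)
  ext i
  rw [seq, sortedDesc_coe hp]
  rcases lt_or_ge i M with hi | hi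
  · rw [List.getD_eq_getElem _ _ (by simpa using hi)]
    simp
  · rw [List.getD_eq_default _ _ (by simpa using hi), hM i hi]

theorem exists_posParts_seq_eq {F : ℕ → ℕ} (hF : Antitone F) (h0 : ∃ N, F N = 0) :
    ∃ s, PosParts s ∧ seq s = F := by
  classical
  refine ⟨((List.range (Nat.find h0)).map F : List ℕ), ?_, seq_coe_map_range hF fun i hi => ?_⟩
  · intro x hx
    simp only [Multiset.mem_coe, List.mem_map, List.mem_range] at hx
    obtain ⟨i, hi, rfl⟩ := hx
    exact Nat.pos_of_ne_zero (Nat.find_min h0 hi)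
  · exact Nat.le_zero.1 ((hF hi).trans (Nat.find_spec h0).le)

theorem seq_transpose (s : Multiset ℕ) (j : ℕ) :
    seq (transpose s) j = (s.filter (fun x => j + 1 ≤ x)).card := by
  have hF : Antitone fun j => (s.filter (fun x => j + 1 ≤ x)).card := fun i j hij =>
    Multiset.card_le_card (Multiset.monotone_filter_right s fun x (hx : j + 1 ≤ x) => by omega)
  have h : transpose s = (((List.range (part s 1)).map
      fun j => (s.filter (fun x => j + 1 ≤ x)).card : List ℕ) : Multiset ℕ) := rfl
  rw [h, seq_coe_map_range hF]
  intro i hi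
  rw [Multiset.card_eq_zero, Multiset.filter_eq_nil]
  intro x hx hix
  obtain ⟨k, _, rfl⟩ := exists_seq_eq hx
  have : seq s k ≤ part s 1 := seq_antitone s (Nat.zero_le k)
  omega

theorem seq_transpose_eq_add_count (s : Multiset ℕ) (j : ℕ) :
    seq (transpose s) j = seq (transpose s) (j + 1) + s.count (j + 1) := by
  rw [seq_transpose, seq_transpose]
  induction s using Multiset.induction_on with
  | empty => simp
  | cons a s ih =>
    simp only [← Multiset.countP_eq_card_filter, Multiset.countP_cons, Multiset.count_cons] at ih ⊢
    split_ifs <;> omega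

theorem card_filter_even_add_sum (f : ℕ → ℕ) (j : ℕ) :
    (((Finset.range j).filter (fun i => Even (f i))).card + ∑ i ∈ Finset.range j, f i) % 2
      = j % 2 := by
  induction j with
  | zero => simp
  | succ j ih =>
    rw [Finset.card_filter, Finset.sum_range_succ, Finset.sum_range_succ, ← Finset.card_filter]
    split_ifs with h <;> grind

/-- In a D-partition, the sum of the `j` largest parts has the parity of `j` at every descent. -/
theorem IsTypeD.psum_parity {s : Multiset ℕ} (hs : IsTypeD s) {j : ℕ}
    (h : seq s (j + 1) < seq s j) : psum s (j + 1) % 2 = (j + 1) % 2 := by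
  have hcard : Even ((Finset.range (j + 1)).filter (fun i => Even (seq s i))).card := by
    rw [Finset.card_eq_sum_card_image (seq s), even_iff_two_dvd]
    refine Finset.dvd_sum fun v hv => even_iff_two_dvd.1 ?_
    obtain ⟨i, hi, rfl⟩ := Finset.mem_image.1 hv
    rw [Finset.mem_filter, Finset.mem_range] at hi
    have hji : seq s j ≤ seq s i := seq_antitone s (by omega)
    have hcount := hs.2.2 _ hi.2
    rw [count_eq (by omega) le_rfl] at hcount
    refine (congrArg (fun S : Finset ℕ => Even S.card) ?_).mpr hcount
    ext k
    simp only [Finset.mem_filter, Finset.mem_range]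
    constructor
    · rintro ⟨-, h₂⟩
      refine ⟨?_, h₂⟩
      by_contra hk
      rw [seq_eq_zero (by omega)] at h₂
      omega
    · rintro ⟨-, h₂⟩
      refine ⟨⟨?_, h₂ ▸ hi.2⟩, h₂⟩
      by_contra hk
      have : seq s k ≤ seq s (j + 1) := seq_antitone s (by omega)
      omega
  have := card_filter_even_add_sum (seq s) (j + 1)
  rw [← psum_eq] at this
  grind

theorem exists_psum_parity_of_descents {s : Multiset ℕ}
    (h : ∀ j, seq s (j + 1) < seq s j → psum s (j + 1) % 2 = (j + 1) % 2) {x : ℕ} (hx : 0 < x) :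
    ∃ a ≤ s.card, psum s a % 2 = a % 2 ∧ ∀ i, i < a ↔ x ≤ seq s i := by
  classical
  have hex : ∃ a, seq s a < x := ⟨s.card, by rwa [seq_eq_zero le_rfl]⟩
  refine ⟨Nat.find hex, Nat.find_min' hex (by rwa [seq_eq_zero le_rfl]), ?_, fun i => ?_⟩
  · rcases hk : Nat.find hex with _ | k
    · simp [psum_eq]
    · have h₁ := Nat.find_spec hex
      have h₂ := Nat.find_min hex (m := k) (by omega)
      rw [hk] at h₁
      exact h k (by omega)
  · refine ⟨fun hi => not_lt.1 (Nat.find_min hex hi), fun hi => ?_⟩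
    by_contra hc
    have := seq_antitone s (not_lt.1 hc)
    have := Nat.find_spec hex
    omega

theorem isTypeD_of_descents {s : Multiset ℕ} (hpos : PosParts s) (hsum : Even s.sum)
    (h : ∀ j, seq s (j + 1) < seq s j → psum s (j + 1) % 2 = (j + 1) % 2) : IsTypeD s := by
  refine ⟨hpos, hsum, fun x hx => ?_⟩
  rcases Nat.eq_zero_or_pos x with rfl | hx0
  · rw [Multiset.count_eq_zero.2 fun h0 => (hpos 0 h0).false]
    exact Even.zero
  obtain ⟨a, ha, hpa, ha'⟩ := exists_psum_parity_of_descents h (Nat.succ_pos x)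
  obtain ⟨b, hb, hpb, hb'⟩ := exists_psum_parity_of_descents h hx0
  have hab : a ≤ b := by
    by_contra hc
    have := (ha' b).1 (by omega)
    have := (hb' b).2 (by omega)
    omega
  have hcount : s.count x = b - a := by
    rw [count_eq hx0 le_rfl, ← Nat.card_Ico]
    congr 1
    ext i
    simp only [Finset.mem_filter, Finset.mem_range, Finset.mem_Ico]
    have := ha' i
    have := hb' i
    omega
  have hsum : psum s b = psum s a + (b - a) * x := by
    rw [psum_eq, psum_eq, ← Finset.sum_range_add_sum_Ico _ hab]
    congr 1
    rw [Finset.sum_eq_card_nsmul (b := x), Nat.card_Ico, smul_eq_mul]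
    intro i hi
    rw [Finset.mem_Ico] at hi
    have := ha' i
    have := hb' i
    omega
  have : Even ((b - a) * x) := hx.mul_left _
  rw [hcount]
  grind

/-- The amount by which the `j`-th partial sum of `f` drops under the D-collapse, when `f` is the
sequence of parts of the transpose of a D-partition. -/
def collapseDrop (f : ℕ → ℕ) : ℕ → ℕ
  | 0 => 0
  | j + 1 => if Even (f j) ∧ Even (f (j + 1)) ∧ (Odd j ∨ f j = f (j + 1)) then 0 else 1

theorem collapseDrop_le_one (f : ℕ → ℕ) (j : ℕ) : collapseDrop f j ≤ 1 := by
  cases j <;> grind [collapseDrop]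

theorem collapseDrop_eq_one_of_odd {f : ℕ → ℕ} (h0 : Even (f 0)) {j : ℕ} (h : Odd (f j)) :
    collapseDrop f j = 1 ∧ collapseDrop f (j + 1) = 1 := by
  cases j <;> grind [collapseDrop]

/-- The sequence of parts of the D-collapse, when `f` is the sequence of parts of the transpose
of a D-partition. -/
def collapseSeq (f : ℕ → ℕ) (j : ℕ) : ℕ := f j + collapseDrop f j - collapseDrop f (j + 1)

theorem collapseSeq_add_collapseDrop {f : ℕ → ℕ} (hf : Antitone f) (j : ℕ) :
    collapseSeq f j + collapseDrop f (j + 1) = f j + collapseDrop f j := by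
  rw [collapseSeq]
  refine Nat.sub_add_cancel ?_
  have := hf (Nat.le_succ j)
  grind [collapseDrop]

theorem collapseSeq_of_odd {f : ℕ → ℕ} (h0 : Even (f 0)) {j : ℕ} (h : Odd (f j)) :
    collapseSeq f j = f j := by
  obtain ⟨h₁, h₂⟩ := collapseDrop_eq_one_of_odd h0 h
  rw [collapseSeq, h₁, h₂, Nat.add_sub_cancel]

theorem collapseSeq_antitone {f : ℕ → ℕ} (hf : Antitone f) (h0 : Even (f 0)) :
    Antitone (collapseSeq f) := by
  refine antitone_nat_of_succ_le fun j => ?_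
  have h₁ := collapseSeq_add_collapseDrop hf j
  have h₂ := collapseSeq_add_collapseDrop hf (j + 1)
  have h₃ : f (j + 1) ≤ f j := hf (Nat.le_succ j)
  have h₄ := collapseDrop_le_one f (j + 1)
  rcases Nat.even_or_odd (f j) with h | h <;> rcases Nat.even_or_odd (f (j + 1)) with h' | h'
  · have : collapseDrop f (j + 1) = 0 ∨ f (j + 1) + 2 ≤ f j := by
      grind [collapseDrop]
    omega
  · have := collapseDrop_eq_one_of_odd h0 h'
    grind
  · have := collapseDrop_eq_one_of_odd h0 h
    grind
  · have := collapseDrop_eq_one_of_odd h0 h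
    have := collapseDrop_eq_one_of_odd h0 h'
    omega

theorem psum_add_collapseDrop {s t : Multiset ℕ} (h : seq s = collapseSeq (seq t)) (j : ℕ) :
    psum s j + collapseDrop (seq t) j = psum t j := by
  induction j with
  | zero => simp [psum_eq, collapseDrop]
  | succ j ih =>
    have := collapseSeq_add_collapseDrop (seq_antitone t) j
    rw [psum_succ, psum_succ, h]
    omega

theorem psum_succ_parity {t : Multiset ℕ} (h0 : Even (seq t 0))
    (hpair : ∀ j, Odd j → seq t j % 2 = seq t (j + 1) % 2) (j : ℕ) :
    psum t (j + 1) % 2 = if Even j then 0 else seq t j % 2 := by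
  induction j with
  | zero => simpa [psum_eq, Nat.even_iff] using h0
  | succ j ih =>
    rw [psum_succ]
    have := hpair j
    grind

theorem psum_parity_of_collapseDrop_eq_one {t : Multiset ℕ} (h0 : Even (seq t 0))
    (hpair : ∀ j, Odd j → seq t j % 2 = seq t (j + 1) % 2) {j : ℕ}
    (hj : collapseDrop (seq t) (j + 1) = 1) : psum t (j + 1) % 2 = j % 2 := by
  have h₁ := psum_succ_parity h0 hpair j
  have h₂ := hpair j
  grind [collapseDrop]

theorem psum_parity_of_seq_eq_collapseSeq {s t : Multiset ℕ} (h0 : Even (seq t 0))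
    (hpair : ∀ j, Odd j → seq t j % 2 = seq t (j + 1) % 2) (hs : seq s = collapseSeq (seq t))
    {j : ℕ} (hj : seq s (j + 1) < seq s j) : psum s (j + 1) % 2 = (j + 1) % 2 := by
  have h₁ := psum_add_collapseDrop hs (j + 1)
  have h₂ := collapseDrop_le_one (seq t) (j + 1)
  rcases Nat.eq_zero_or_pos (collapseDrop (seq t) (j + 1)) with h | h
  · have h₃ := psum_succ_parity h0 hpair j
    rcases Nat.even_or_odd j with he | ho
    · have h₄ := collapseSeq_add_collapseDrop (seq_antitone t) j
      have h₅ := collapseSeq_add_collapseDrop (seq_antitone t) (j + 1)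
      have h₆ : seq t j = seq t (j + 1) ∧ Even (seq t j) := by grind [collapseDrop]
      have h₇ : collapseDrop (seq t) (j + 1 + 1) = 0 := by
        have := hpair (j + 1) he.add_one
        grind [collapseDrop]
      have h₈ : collapseDrop (seq t) j = 0 := by
        rcases j with _ | k
        · rfl
        · have := hpair k (by grind)
          grind [collapseDrop]
      rw [hs] at hj
      omega
    · grind [collapseDrop]
  · have := psum_parity_of_collapseDrop_eq_one h0 hpair (j := j) (by omega)
    omega

theorem psum_ne_of_collapseDrop_eq_one {s t : Multiset ℕ} (h0 : Even (seq t 0))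
    (hpair : ∀ j, Odd j → seq t j % 2 = seq t (j + 1) % 2) (hs : IsTypeD s) (hle : DomLE s t)
    {j : ℕ} (hj : collapseDrop (seq t) (j + 1) = 1) : psum s (j + 1) ≠ psum t (j + 1) := by
  intro heq
  have step : ∀ j, collapseDrop (seq t) (j + 1) = 1 → psum s (j + 1) = psum t (j + 1) →
      Odd (seq t (j + 1)) ∧ psum s (j + 1 + 1) = psum t (j + 1 + 1) := by
    intro j hj heq
    have h₁ := psum_parity_of_collapseDrop_eq_one h0 hpair hj
    have h₂ := hs.psum_parity (j := j)
    have h₃ := hle j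
    have h₄ := hle (j + 1 + 1)
    have h₅ := psum_succ s j
    have h₆ := psum_succ t j
    have h₇ : seq t (j + 1) ≤ seq t j := seq_antitone t (Nat.le_succ j)
    rw [psum_succ s (j + 1), psum_succ t (j + 1)] at h₄ ⊢
    have h₈ : seq t (j + 1) = seq t j := by omega
    refine ⟨?_, by omega⟩
    grind [collapseDrop]
  have all : ∀ k, collapseDrop (seq t) (j + k + 1) = 1 ∧
      psum s (j + k + 1) = psum t (j + k + 1) := by
    intro k
    induction k with
    | zero => exact ⟨hj, heq⟩
    | succ k ih =>
      obtain ⟨h₁, h₂⟩ := step _ ih.1 ih.2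
      exact ⟨(collapseDrop_eq_one_of_odd h0 h₁).2, h₂⟩
  have h := (step _ (all t.card).1 (all t.card).2).1
  rw [seq_eq_zero (by omega)] at h
  simp at h

theorem IsCollapse.seq_eq {t d : Multiset ℕ} (hd : IsCollapse IsTypeD t d) (h0 : Even (seq t 0))
    (hpair : ∀ j, Odd j → seq t j % 2 = seq t (j + 1) % 2) : seq d = collapseSeq (seq t) := by
  obtain ⟨hdD, hsum, hle, hmax⟩ := hd
  have hzero : ∀ i, t.card ≤ i → collapseDrop (seq t) (i + 1) = 0 := by
    intro i hi
    rw [collapseDrop, seq_eq_zero hi, seq_eq_zero (hi.trans (Nat.le_succ i))]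
    simp
  obtain ⟨s, hpos, hs⟩ := exists_posParts_seq_eq (collapseSeq_antitone (seq_antitone t) h0)
    ⟨t.card + 1, by
      rw [collapseSeq, hzero _ le_rfl, seq_eq_zero (Nat.le_succ _)]
      simp⟩
  have hpsum := psum_add_collapseDrop hs
  have hsum' : s.sum = t.sum := by
    have := hpsum (t.card + s.card + 1)
    rwa [hzero _ (by omega), psum_eq_sum (by omega), psum_eq_sum (by omega)] at this
  have hsD : IsTypeD s := isTypeD_of_descents hpos (by rw [hsum', ← hsum]; exact hdD.2.1)
    fun j => psum_parity_of_seq_eq_collapseSeq h0 hpair hs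
  have hsd : DomLE s d := hmax s hsD hsum' fun j => by have := hpsum j; omega
  have hds : DomLE d s := by
    rintro (_ | j)
    · simp [psum_eq]
    · have h₁ := hpsum (j + 1)
      have h₂ := hle (j + 1)
      have h₃ := collapseDrop_le_one (seq t) (j + 1)
      have h₄ := psum_ne_of_collapseDrop_eq_one h0 hpair hdD hle (j := j)
      omega
  have heq : ∀ j, psum d j = psum s j := fun j => le_antisymm (hds j) (hsd j)
  ext j
  have h₁ := heq j
  have h₂ := heq (j + 1)
  rw [psum_succ, psum_succ] at h₂
  rw [← hs]
  omega

theorem IsCollapse.count_le_of_odd {t d : Multiset ℕ} (hd : IsCollapse IsTypeD t d)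
    (h0 : Even (seq t 0)) (hpair : ∀ j, Odd j → seq t j % 2 = seq t (j + 1) % 2) {x : ℕ}
    (hx : Odd x) : t.count x ≤ d.count x := by
  rw [count_eq hx.pos (Nat.le_add_right t.card d.card),
    count_eq hx.pos (Nat.le_add_left d.card t.card), hd.seq_eq h0 hpair]
  refine Finset.card_le_card (Finset.monotone_filter_right _ fun i _ hi => ?_)
  subst hi
  exact collapseSeq_of_odd h0 hx

theorem count_muOdd (t : Multiset ℕ) (x : ℕ) :
    (muOdd t).count x =
      if x ∈ t ∧ Odd x then (if Even (t.count x) then 2 else 1) else 0 := by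
  rw [muOdd, Multiset.count_bind]
  change ∑ y ∈ t.toFinset.filter (fun y => Odd y),
    Multiset.count x (Multiset.replicate (if Even (t.count y) then 2 else 1) y) = _
  simp [Multiset.count_replicate]

theorem count_muOdd_le (t : Multiset ℕ) (x : ℕ) : (muOdd t).count x ≤ t.count x := by
  rw [count_muOdd]
  split_ifs with h h'
  · have := Multiset.count_pos.2 h.1
    grind
  · exact Multiset.count_pos.2 h.1
  · exact Nat.zero_le _

theorem IsTypeD.seq_transpose_parity {s : Multiset ℕ} (hs : IsTypeD s) {j : ℕ} (hj : Odd j) :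
    seq (transpose s) j % 2 = seq (transpose s) (j + 1) % 2 := by
  have h₁ := seq_transpose_eq_add_count s j
  have h₂ := hs.2.2 (j + 1) hj.add_one
  grind

theorem odd_psum_of_pairs {t : Multiset ℕ} (h0 : Odd (seq t 0))
    (hpair : ∀ j, Odd j → seq t j % 2 = seq t (j + 1) % 2) (k : ℕ) :
    Odd (psum t (2 * k + 1)) := by
  induction k with
  | zero => simpa [psum_eq] using h0
  | succ k ih =>
    have := hpair (2 * k + 1) (odd_two_mul_add_one k)
    rw [show 2 * (k + 1) + 1 = 2 * k + 1 + 1 + 1 by ring, psum_succ, psum_succ]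
    grind

theorem even_seq_zero_of_even_sum {t : Multiset ℕ} (hsum : Even t.sum)
    (hpair : ∀ j, Odd j → seq t j % 2 = seq t (j + 1) % 2) : Even (seq t 0) := by
  by_contra h
  have := odd_psum_of_pairs (Nat.not_even_iff_odd.1 h) hpair t.card
  rw [psum_eq_sum (by omega)] at this
  exact Nat.not_even_iff_odd.2 this hsum

/-- For a D-partition `λ` of `n ≥ 1` with `|μ(λ)| ∉ {2, 2n-2}` and
`d(λ) = (λᵗ)_D`, one has `μ(λ) ⊆ d(λ)`. -/
theorem statement8 (n : ℕ) (hn : 1 ≤ n) (l : Multiset ℕ)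
    (hD : IsTypeD l ∧ l.sum = 2 * n)
    (hmu : (muOdd (transpose l)).sum ≠ 2 ∧ (muOdd (transpose l)).sum ≠ 2 * n - 2)
    (d : Multiset ℕ) (hd : IsCollapse IsTypeD (transpose l) d) :
    muOdd (transpose l) ≤ d := by
  have hpair : ∀ j, Odd j → seq (transpose l) j % 2 = seq (transpose l) (j + 1) % 2 :=
    fun _ => hD.1.seq_transpose_parity
  have h0 : Even (seq (transpose l) 0) :=
    even_seq_zero_of_even_sum (by rw [← hd.2.1]; exact hd.1.2.1) hpair
  refine Multiset.le_iff_count.2 fun x => ?_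
  rcases Nat.even_or_odd x with hx | hx
  · simp [count_muOdd, Nat.not_odd_iff_even.2 hx]
  · exact (count_muOdd_le _ x).trans (hd.count_le_of_odd h0 hpair hx)

end WFPaper
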